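/- Let d = 2. There exist η₀ > 0 and a universal constant C ≥ 1 such that: for every r ≥ 2 and every solution v of the hodograph PDE on the half-annulus A_r = {y : 1 ≤ |y| ≤ r, y₂ ≥ 0} satisfying |∇v(y)| ≤ η₀ for all y ∈ A_r, one has max_{∂B_r⁺} v ≥ max_{∂B₁⁺} v − C(1+log r)·(max_{∂B₁⁺} v − max_{∂B₂⁺} v)₊ and min_{∂B_r⁺} v ≤ min_{∂B₁⁺} v + C(1+log r)·(min_{∂B₂⁺} v − min_{∂B₁⁺} v)₊, where (t)₊ = max(t,0). -/

import Mathlib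

open Real Set Filter MeasureTheory

noncomputable section

/-- The last index of `Fin d`. -/
def lastIdx (d : ℕ) (hd : 0 < d) : Fin d := ⟨d - 1, by omega⟩

/-- The `i`-th partial derivative of `v` at `y`. -/
def gradC (d : ℕ) (v : EuclideanSpace ℝ (Fin d) → ℝ)
    (y : EuclideanSpace ℝ (Fin d)) (i : Fin d) : ℝ :=
  fderiv ℝ v y (EuclideanSpace.single i 1)

/-- The `(i,j)` entry of the Hessian of `v` at `y`. -/
def hessC (d : ℕ) (v : EuclideanSpace ℝ (Fin d) → ℝ)
    (y : EuclideanSpace ℝ (Fin d)) (i j : Fin d) : ℝ :=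
  fderiv ℝ (fun z => fderiv ℝ v z (EuclideanSpace.single i 1)) y (EuclideanSpace.single j 1)

/-- The squared euclidean norm of the tangential part `p'` of `p`. -/
def tangSq (d : ℕ) (hd : 0 < d) (p : Fin d → ℝ) : ℝ :=
  ∑ m : Fin d, if m = lastIdx d hd then 0 else (p m) ^ 2

/-- The coefficient matrix `A(p)` of the hodograph PDE. -/
def hodA (d : ℕ) (hd : 0 < d) (p : Fin d → ℝ) (i j : Fin d) : ℝ :=
  if i = lastIdx d hd then
    (if j = lastIdx d hd then (1 + tangSq d hd p) / (1 + p (lastIdx d hd)) ^ 2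
     else p j / (1 + p (lastIdx d hd)))
  else
    (if j = lastIdx d hd then p i / (1 + p (lastIdx d hd))
     else if i = j then 1 else 0)

/-- The boundary nonlinearity `N(p') = √(1 + |p'|²) - 1`. -/
def hodN (d : ℕ) (hd : 0 < d) (p : Fin d → ℝ) : ℝ :=
  Real.sqrt (1 + tangSq d hd p) - 1

/-- The quantity `tr(A(∇v(y)) D²v(y))`. -/
def hodOp (d : ℕ) (hd : 0 < d) (v : EuclideanSpace ℝ (Fin d) → ℝ)
    (y : EuclideanSpace ℝ (Fin d)) : ℝ :=
  ∑ i : Fin d, ∑ j : Fin d, hodA d hd (fun m => gradC d v y m) i j * hessC d v y i j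

/-- `v` is `C^∞` on an open neighborhood of `U`. -/
def SmoothNear (d : ℕ) (v : EuclideanSpace ℝ (Fin d) → ℝ)
    (U : Set (EuclideanSpace ℝ (Fin d))) : Prop :=
  ∃ W : Set (EuclideanSpace ℝ (Fin d)), IsOpen W ∧ U ⊆ W ∧ ContDiffOn ℝ (⊤ : ℕ∞) v W

/-- `v` is a (classical) solution of the hodograph PDE on `U`. -/
def IsHodSol (d : ℕ) (hd : 0 < d) (v : EuclideanSpace ℝ (Fin d) → ℝ)
    (U : Set (EuclideanSpace ℝ (Fin d))) : Prop :=
  SmoothNear d v U ∧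
  (∀ y ∈ U, 0 < y (lastIdx d hd) → hodOp d hd v y = 0) ∧
  (∀ y ∈ U, y (lastIdx d hd) = 0 →
    gradC d v y (lastIdx d hd) = hodN d hd (fun m => gradC d v y m))

/-- `v` is a subsolution of the hodograph PDE on `U`. -/
def IsHodSubsol (d : ℕ) (hd : 0 < d) (v : EuclideanSpace ℝ (Fin d) → ℝ)
    (U : Set (EuclideanSpace ℝ (Fin d))) : Prop :=
  SmoothNear d v U ∧
  (∀ y ∈ U, 0 < y (lastIdx d hd) → 0 ≤ hodOp d hd v y) ∧
  (∀ y ∈ U, y (lastIdx d hd) = 0 →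
    hodN d hd (fun m => gradC d v y m) ≤ gradC d v y (lastIdx d hd))

/-- `v` is a supersolution of the hodograph PDE on `U`. -/
def IsHodSupersol (d : ℕ) (hd : 0 < d) (v : EuclideanSpace ℝ (Fin d) → ℝ)
    (U : Set (EuclideanSpace ℝ (Fin d))) : Prop :=
  SmoothNear d v U ∧
  (∀ y ∈ U, 0 < y (lastIdx d hd) → hodOp d hd v y ≤ 0) ∧
  (∀ y ∈ U, y (lastIdx d hd) = 0 →
    gradC d v y (lastIdx d hd) ≤ hodN d hd (fun m => gradC d v y m))

/-- The exterior half-space domain `H₁ = {y : y_d ≥ 0, |y| ≥ 1}`. -/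
def extDom (d : ℕ) (hd : 0 < d) : Set (EuclideanSpace ℝ (Fin d)) :=
  {y | 0 ≤ y (lastIdx d hd) ∧ 1 ≤ ‖y‖}

/-- The half annulus `A_r = {y : 1 ≤ |y| ≤ r, y_d ≥ 0}`. -/
def halfAnn (d : ℕ) (hd : 0 < d) (r : ℝ) : Set (EuclideanSpace ℝ (Fin d)) :=
  {y | 0 ≤ y (lastIdx d hd) ∧ 1 ≤ ‖y‖ ∧ ‖y‖ ≤ r}

/-- The upper half sphere `∂B_ρ⁺ = {y : y_d ≥ 0, |y| = ρ}`. -/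
def upSphere (d : ℕ) (hd : 0 < d) (ρ : ℝ) : Set (EuclideanSpace ℝ (Fin d)) :=
  {y | 0 ≤ y (lastIdx d hd) ∧ ‖y‖ = ρ}

/-- The filter of `|y| → ∞` within `H₁`. -/
def farFilter (d : ℕ) (hd : 0 < d) : Filter (EuclideanSpace ℝ (Fin d)) :=
  (Filter.comap (fun y : EuclideanSpace ℝ (Fin d) => ‖y‖) Filter.atTop) ⊓
    Filter.principal (extDom d hd)

open scoped Topology

lemma IsLocalMin.second_deriv_nonneg {g g' : ℝ → ℝ} {x c : ℝ}
    (hg : ∀ᶠ τ in 𝓝 x, HasDerivAt g (g' τ) τ) (hg' : HasDerivAt g' c x)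
    (hmin : IsLocalMin g x) : 0 ≤ c := by
  by_contra! hc
  have hd : deriv g =ᶠ[𝓝 x] g' := hg.mono fun τ h => h.deriv
  have h2 : deriv (deriv g) x = c := hd.deriv_eq.trans hg'.deriv
  have hmax : IsLocalMax g x :=
    isLocalMax_of_deriv_deriv_neg (by rw [h2]; exact hc) hmin.deriv_eq_zero
      hg.self_of_nhds.continuousAt
  have hconst : g =ᶠ[𝓝 x] fun _ => g x := by
    filter_upwards [hmin, hmax] with τ h1 h3
    exact le_antisymm h3 h1
  have h4 : deriv (deriv g) x = 0 := by
    rw [hconst.deriv.deriv_eq]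
    simp
  linarith

/-- The barrier `log ρ + 1/(2ρ) + b/(8ρ²) - 5/8`, with `ρ² = a² + b²`. -/
def barrier (a b : ℝ) : ℝ :=
  Real.log (a ^ 2 + b ^ 2) / 2 + (√(a ^ 2 + b ^ 2))⁻¹ / 2 + b / (8 * (a ^ 2 + b ^ 2)) - 5 / 8

/-- The derivative of `barrier` at `(a, b)` in the direction `(α, β)`. -/
def barrierD (a b α β : ℝ) : ℝ :=
  (a * α + b * β) / (a ^ 2 + b ^ 2) - (a * α + b * β) / (2 * √(a ^ 2 + b ^ 2) ^ 3)
    + β / (8 * (a ^ 2 + b ^ 2)) - b * (a * α + b * β) / (4 * (a ^ 2 + b ^ 2) ^ 2)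

/-- The second derivative of `barrier` at `(a, b)` in the direction `(α, β)`. -/
def barrierDD (a b α β : ℝ) : ℝ :=
  (α ^ 2 + β ^ 2) / (a ^ 2 + b ^ 2) - 2 * (a * α + b * β) ^ 2 / (a ^ 2 + b ^ 2) ^ 2
    - (α ^ 2 + β ^ 2) / (2 * √(a ^ 2 + b ^ 2) ^ 3)
    + 3 * (a * α + b * β) ^ 2 / (2 * √(a ^ 2 + b ^ 2) ^ 5)
    - β * (a * α + b * β) / (2 * (a ^ 2 + b ^ 2) ^ 2)
    - b * (α ^ 2 + β ^ 2) / (4 * (a ^ 2 + b ^ 2) ^ 2)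
    + b * (a * α + b * β) ^ 2 / (a ^ 2 + b ^ 2) ^ 3

lemma hasDerivAt_affine (a α τ : ℝ) : HasDerivAt (fun x => a + x * α) α τ := by
  simpa using ((hasDerivAt_id τ).mul_const α).const_add a

lemma hasDerivAt_sq_add_sq (a b α β τ : ℝ) :
    HasDerivAt (fun x => (a + x * α) ^ 2 + (b + x * β) ^ 2)
      (2 * ((a + τ * α) * α + (b + τ * β) * β)) τ := by
  refine (((hasDerivAt_affine a α τ).pow 2).add ((hasDerivAt_affine b β τ).pow 2)).congr_deriv ?_
  ring

lemma hasDerivAt_barrier (a b α β τ : ℝ) (hq : 0 < (a + τ * α) ^ 2 + (b + τ * β) ^ 2) :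
    HasDerivAt (fun x => barrier (a + x * α) (b + x * β))
      (barrierD (a + τ * α) (b + τ * β) α β) τ := by
  have hQ := hasDerivAt_sq_add_sq a b α β τ
  have hS := hQ.sqrt hq.ne'
  have hs : 0 < √((a + τ * α) ^ 2 + (b + τ * β) ^ 2) := Real.sqrt_pos.2 hq
  have hss := Real.sq_sqrt hq.le
  have h := ((((hQ.log hq.ne').div_const 2).add ((hS.inv hs.ne').div_const 2)).add
    ((hasDerivAt_affine b β τ).div (hQ.const_mul 8) (by positivity))).sub_const (5 / 8)
  refine h.congr_deriv ?_
  unfold barrierD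
  set s := √((a + τ * α) ^ 2 + (b + τ * β) ^ 2)
  set q := (a + τ * α) ^ 2 + (b + τ * β) ^ 2
  field_simp
  ring

lemma hasDerivAt_barrierD (a b α β : ℝ) (hq : 0 < a ^ 2 + b ^ 2) :
    HasDerivAt (fun x => barrierD (a + x * α) (b + x * β) α β) (barrierDD a b α β) 0 := by
  have hQ := hasDerivAt_sq_add_sq a b α β 0
  have hB := hasDerivAt_affine b β 0
  have hL : HasDerivAt (fun x => (a + x * α) * α + (b + x * β) * β) (α * α + β * β) 0 :=
    ((hasDerivAt_affine a α 0).mul_const α).add (hB.mul_const β)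
  have hq0 : 0 < (a + 0 * α) ^ 2 + (b + 0 * β) ^ 2 := by simpa using hq
  have hs : 0 < √((a + 0 * α) ^ 2 + (b + 0 * β) ^ 2) := Real.sqrt_pos.2 hq0
  have hS : HasDerivAt (fun x => 2 * √((a + x * α) ^ 2 + (b + x * β) ^ 2) ^ 3) _ 0 :=
    ((hQ.sqrt hq0.ne').pow 3).const_mul 2
  have hQ2 : HasDerivAt (fun x => 4 * ((a + x * α) ^ 2 + (b + x * β) ^ 2) ^ 2) _ 0 :=
    (hQ.pow 2).const_mul 4
  have hBL : HasDerivAt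
      (fun x => (b + x * β) * ((a + x * α) * α + (b + x * β) * β)) _ 0 := hB.mul hL
  have h := (((hL.div hQ hq0.ne').sub (hL.div hS (by positivity))).add
    ((hasDerivAt_const (0 : ℝ) β).div (hQ.const_mul 8) (by positivity))).sub
    (hBL.div hQ2 (by positivity))
  refine h.congr_deriv ?_
  unfold barrierDD
  simp only [zero_mul, add_zero] at hs ⊢
  have hss := Real.sq_sqrt hq.le
  set s := √(a ^ 2 + b ^ 2)
  rw [← hss]
  clear_value s
  field_simp
  ring

lemma barrierD_polar {k c s : ℝ} (hk : 0 < k) (h : c ^ 2 + s ^ 2 = 1) (α β : ℝ) :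
    barrierD (c / k) (s / k) α β = k * ((c * α + s * β) - k * (c * α + s * β) / 2
      + k * β / 8 - k * s * (c * α + s * β) / 4) := by
  have hq : (c / k) ^ 2 + (s / k) ^ 2 = (1 / k) ^ 2 := by
    field_simp
    linarith
  unfold barrierD
  rw [hq, Real.sqrt_sq (by positivity)]
  field_simp

lemma barrierDD_polar {k c s : ℝ} (hk : 0 < k) (h : c ^ 2 + s ^ 2 = 1) (α β : ℝ) :
    barrierDD (c / k) (s / k) α β = k ^ 2 * ((α ^ 2 + β ^ 2) - 2 * (c * α + s * β) ^ 2
      + k * (-(α ^ 2 + β ^ 2) / 2 + 3 * (c * α + s * β) ^ 2 / 2 - β * (c * α + s * β) / 2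
        - s * (α ^ 2 + β ^ 2) / 4 + s * (c * α + s * β) ^ 2)) := by
  have hq : (c / k) ^ 2 + (s / k) ^ 2 = (1 / k) ^ 2 := by
    field_simp
    linarith
  unfold barrierDD
  rw [hq, Real.sqrt_sq (by positivity)]
  field_simp
  ring

lemma exists_polar {a b : ℝ} (hq : 1 ≤ a ^ 2 + b ^ 2) :
    ∃ k c s : ℝ, 0 < k ∧ k ≤ 1 ∧ c ^ 2 + s ^ 2 = 1 ∧ a = c / k ∧ b = s / k := by
  have hs : 1 ≤ √(a ^ 2 + b ^ 2) := Real.one_le_sqrt.2 hq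
  have hss := Real.sq_sqrt (zero_le_one.trans hq)
  set ρ := √(a ^ 2 + b ^ 2)
  have hρ : 0 < ρ := by linarith
  refine ⟨ρ⁻¹, a * ρ⁻¹, b * ρ⁻¹, by positivity, inv_le_one_of_one_le₀ hs, ?_, ?_, ?_⟩
  · field_simp
    linarith
  · field_simp
  · field_simp

lemma quadratic_perturbation_pos {k x y q11 q12 q22 : ℝ} (hk : 0 < k) (hk1 : k ≤ 1)
    (hxb : |x| ≤ k / 100) (hyb : |y| ≤ k / 100) (h11 : |q11| ≤ 5) (h12 : |q12| ≤ 5)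
    (h22 : |q22| ≤ 5) (hsum : q11 + q22 = k / 2) :
    0 < q11 + q22 + ((2 + x) * x * q11 + 2 * (1 + x) * y * q12 + y * y * q22) := by
  have hE1 : |(2 + x) * x * q11| ≤ 201 / 100 * (k / 100) * 5 := by
    rw [abs_mul, abs_mul]
    gcongr
    rw [abs_le] at hxb ⊢
    constructor <;> linarith
  have hE2 : |2 * (1 + x) * y * q12| ≤ 202 / 100 * (k / 100) * 5 := by
    rw [abs_mul, abs_mul]
    gcongr
    rw [abs_le] at hxb ⊢
    constructor <;> linarith
  have hE3 : |y * y * q22| ≤ 1 / 100 * (k / 100) * 5 := by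
    rw [abs_mul, abs_mul]
    gcongr
    linarith
  rw [abs_le] at hE1 hE2 hE3
  linarith

lemma barrier_coeff_bounds {k c s : ℝ} (hk : 0 < k) (hk1 : k ≤ 1) (hcs : c ^ 2 + s ^ 2 = 1)
    (hc : -1 ≤ c ∧ c ≤ 1) (hs : -1 ≤ s ∧ s ≤ 1) :
    |1 - 2 * c ^ 2 + k * (-1 / 2 + 3 * c ^ 2 / 2 - s / 4 + s * c ^ 2)| ≤ 5 ∧
    |-2 * c * s + k * (3 * c * s / 2 - c / 4 + s * c * s)| ≤ 5 ∧
    |1 - 2 * s ^ 2 + k * (-1 / 2 + 3 * s ^ 2 / 2 - s / 2 - s / 4 + s * s ^ 2)| ≤ 5 := by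
  have hkz : ∀ z : ℝ, |z| ≤ 3 → |k * z| ≤ 3 := fun z hz => by
    rw [abs_mul, abs_of_pos hk]
    exact (mul_le_of_le_one_left (abs_nonneg z) hk1).trans hz
  have hc2b : 0 ≤ c ^ 2 ∧ c ^ 2 ≤ 1 := ⟨sq_nonneg c, by nlinarith⟩
  have hs2b : 0 ≤ s ^ 2 ∧ s ^ 2 ≤ 1 := ⟨sq_nonneg s, by nlinarith⟩
  have hcsb : -1 ≤ c * s ∧ c * s ≤ 1 := ⟨by nlinarith [sq_nonneg (c + s)],
    by nlinarith [sq_nonneg (c - s)]⟩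
  have hsc2 : -1 ≤ s * c ^ 2 ∧ s * c ^ 2 ≤ 1 := ⟨by nlinarith, by nlinarith⟩
  have hss2 : -1 ≤ s * s ^ 2 ∧ s * s ^ 2 ≤ 1 := ⟨by nlinarith, by nlinarith⟩
  have hscs : -1 ≤ s * c * s ∧ s * c * s ≤ 1 := ⟨by nlinarith, by nlinarith⟩
  refine ⟨?_, ?_, ?_⟩
  · have h := hkz (-1 / 2 + 3 * c ^ 2 / 2 - s / 4 + s * c ^ 2)
      (by rw [abs_le]; constructor <;> linarith)
    rw [abs_le] at h ⊢
    constructor <;> linarith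
  · have h := hkz (3 * c * s / 2 - c / 4 + s * c * s)
      (by rw [abs_le]; constructor <;> linarith)
    rw [abs_le] at h ⊢
    constructor <;> linarith
  · have h := hkz (-1 / 2 + 3 * s ^ 2 / 2 - s / 2 - s / 4 + s * s ^ 2)
      (by rw [abs_le]; constructor <;> linarith)
    rw [abs_le] at h ⊢
    constructor <;> linarith

/-- `t * barrier` is a strict subsolution (`t > 0`) or supersolution (`t < 0`) in the interior. -/
lemma barrier_interior {a b t : ℝ} (hq : 1 ≤ a ^ 2 + b ^ 2) (ht : |t| ≤ 1 / 200) :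
    0 < barrierDD a b (1 + t * barrierD a b 0 1) (t * barrierD a b 1 0) + barrierDD a b 0 1 := by
  obtain ⟨k, c, s, hk, hk1, hcs, rfl, rfl⟩ := exists_polar hq
  rw [barrierD_polar hk hcs, barrierD_polar hk hcs, barrierDD_polar hk hcs,
    barrierDD_polar hk hcs]
  have hc : |c| ≤ 1 := abs_le_one_iff_mul_self_le_one.2 (by nlinarith)
  have hs : |s| ≤ 1 := abs_le_one_iff_mul_self_le_one.2 (by nlinarith)
  rw [abs_le] at hc hs
  have hc2 : c ^ 2 = 1 - s ^ 2 := by linarith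
  set X := (c * 0 + s * 1) - k * (c * 0 + s * 1) / 2 + k * 1 / 8
    - k * s * (c * 0 + s * 1) / 4 with hX
  set Y := (c * 1 + s * 0) - k * (c * 1 + s * 0) / 2 + k * 0 / 8
    - k * s * (c * 1 + s * 0) / 4 with hY
  have hks : |k * s| ≤ 1 := by
    rw [abs_mul, abs_of_pos hk]
    exact mul_le_one₀ hk1 (abs_nonneg _) (abs_le.2 hs)
  have hkc : |k * c| ≤ 1 := by
    rw [abs_mul, abs_of_pos hk]
    exact mul_le_one₀ hk1 (abs_nonneg _) (abs_le.2 hc)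
  have hkss : |k * s * s| ≤ 1 := by
    rw [abs_mul]
    exact mul_le_one₀ hks (abs_nonneg _) (abs_le.2 hs)
  have hksc : |k * s * c| ≤ 1 := by
    rw [abs_mul]
    exact mul_le_one₀ hks (abs_nonneg _) (abs_le.2 hc)
  rw [abs_le] at hks hkc hkss hksc
  have hXb : |X| ≤ 2 := by rw [abs_le]; constructor <;> (rw [hX]; linarith)
  have hYb : |Y| ≤ 2 := by rw [abs_le]; constructor <;> (rw [hY]; linarith)
  have hxb : |t * (k * X)| ≤ k / 100 := by
    rw [abs_mul, abs_mul, abs_of_pos hk]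
    calc |t| * (k * |X|) ≤ 1 / 200 * (k * 2) := by gcongr
      _ = k / 100 := by ring
  have hyb : |t * (k * Y)| ≤ k / 100 := by
    rw [abs_mul, abs_mul, abs_of_pos hk]
    calc |t| * (k * |Y|) ≤ 1 / 200 * (k * 2) := by gcongr
      _ = k / 100 := by ring
  generalize t * (k * X) = x at hxb
  generalize t * (k * Y) = y at hyb
  clear_value X Y
  set q11 := 1 - 2 * c ^ 2 + k * (-1 / 2 + 3 * c ^ 2 / 2 - s / 4 + s * c ^ 2) with hq11
  set q12 := - 2 * c * s + k * (3 * c * s / 2 - c / 4 + s * c * s) with hq12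
  set q22 := 1 - 2 * s ^ 2 + k * (-1 / 2 + 3 * s ^ 2 / 2 - s / 2 - s / 4 + s * s ^ 2) with hq22
  obtain ⟨h11, h12, h22⟩ := barrier_coeff_bounds hk hk1 hcs hc hs
  rw [← hq11] at h11
  rw [← hq12] at h12
  rw [← hq22] at h22
  have hsum : q11 + q22 = k / 2 := by
    rw [hq11, hq22, hc2]
    ring
  have key := mul_pos (pow_pos hk 2)
    (quadratic_perturbation_pos hk hk1 hxb hyb h11 h12 h22 hsum)
  refine key.trans_le (le_of_eq ?_)
  rw [hq11, hq12, hq22]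
  ring

lemma barrier_boundary {a t : ℝ} (hq : 1 ≤ a ^ 2) (ht : |t| ≤ 1 / 200) (ht0 : t ≠ 0) :
    0 < t * (t * barrierD a 0 0 1 - (√(1 + (t * barrierD a 0 1 0) ^ 2) - 1)) := by
  obtain ⟨k, c, s, hk, hk1, hcs, rfl, hs⟩ := exists_polar (a := a) (b := 0) (by simpa using hq)
  have hs0 : s = 0 := by
    rcases div_eq_zero_iff.1 hs.symm with h | h
    · exact h
    · exact absurd h hk.ne'
  subst hs0
  have hD := barrierD_polar hk hcs
  simp only [zero_div] at hD
  rw [hD, hD]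
  set P := t * (k * ((c * 1 + 0 * 0) - k * (c * 1 + 0 * 0) / 2
      + k * 0 / 8 - k * 0 * (c * 1 + 0 * 0) / 4)) with hP
  have hP2 : P ^ 2 = t ^ 2 * k ^ 2 * (1 - k / 2) ^ 2 := by
    have : c ^ 2 = 1 := by linarith
    calc P ^ 2 = t ^ 2 * k ^ 2 * (1 - k / 2) ^ 2 * c ^ 2 := by rw [hP]; ring
      _ = _ := by rw [this, mul_one]
  have h1 : 1 ≤ √(1 + P ^ 2) := Real.one_le_sqrt.2 (by nlinarith [sq_nonneg P])
  have h2 : √(1 + P ^ 2) ≤ 1 + P ^ 2 / 2 :=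
    Real.sqrt_le_iff.2 ⟨by positivity, by nlinarith [sq_nonneg (P ^ 2)]⟩
  rw [abs_le] at ht
  have hk2 : 0 < k ^ 2 := by positivity
  rcases lt_or_gt_of_ne ht0 with h | h
  · apply mul_pos_of_neg_of_neg h
    nlinarith
  · apply mul_pos h
    have h3 : P ^ 2 ≤ t ^ 2 * k ^ 2 := by
      rw [hP2]
      have : (1 - k / 2) ^ 2 ≤ 1 := by nlinarith
      exact mul_le_of_le_one_right (by positivity) this
    have h4 : t ^ 2 * k ^ 2 < t * k ^ 2 / 8 := by nlinarith [mul_pos h hk2]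
    nlinarith

lemma abs_barrierD_le {a b : ℝ} (hq : 1 ≤ a ^ 2 + b ^ 2) : |barrierD a b 0 1| ≤ 2 := by
  obtain ⟨k, c, s, hk, hk1, hcs, rfl, rfl⟩ := exists_polar hq
  have hs : |s| ≤ 1 := abs_le_one_iff_mul_self_le_one.2 (by nlinarith)
  rw [abs_le] at hs
  have hz : |(c * 0 + s * 1) - k * (c * 0 + s * 1) / 2 + k * 1 / 8
      - k * s * (c * 0 + s * 1) / 4| ≤ 2 := by
    have h1 : -1 ≤ k * s ∧ k * s ≤ 1 := ⟨by nlinarith, by nlinarith⟩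
    have h2 : -1 ≤ k * s * s ∧ k * s * s ≤ 1 := ⟨by nlinarith, by nlinarith⟩
    rw [abs_le]
    constructor <;> linarith
  rw [barrierD_polar hk hcs, abs_mul, abs_of_pos hk]
  exact (mul_le_of_le_one_left (abs_nonneg _) hk1).trans hz

lemma hasDerivAt_add_smul {E : Type*} [NormedAddCommGroup E] [NormedSpace ℝ E] (y e : E) (τ : ℝ) :
    HasDerivAt (fun x : ℝ => y + x • e) e τ := by
  simpa using ((hasDerivAt_id τ).smul_const e).const_add y

section Line

variable {v : EuclideanSpace ℝ (Fin 2) → ℝ} {W : Set (EuclideanSpace ℝ (Fin 2))}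
  {y : EuclideanSpace ℝ (Fin 2)} (hW : IsOpen W) (hv : ContDiffOn ℝ (⊤ : ℕ∞) v W) (hy : y ∈ W)

include hW hy

lemma eventually_line_mem (e : EuclideanSpace ℝ (Fin 2)) : ∀ᶠ τ : ℝ in 𝓝 0, y + τ • e ∈ W := by
  have hc : ContinuousAt (fun τ : ℝ => y + τ • e) 0 := (hasDerivAt_add_smul y e 0).continuousAt
  exact hc.preimage_mem_nhds (by simpa using hW.mem_nhds hy)

include hv

lemma hasFDerivAt_of_smooth : HasFDerivAt v (fderiv ℝ v y) y :=
  ((hv.contDiffAt (hW.mem_nhds hy)).differentiableAt (by simp)).hasFDerivAt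

lemma hasFDerivAt_fderiv_of_smooth :
    HasFDerivAt (fderiv ℝ v) (fderiv ℝ (fderiv ℝ v) y) y :=
  (((hv.contDiffAt (hW.mem_nhds hy)).fderiv_right (m := 1)
    (by norm_cast)).differentiableAt (by simp)).hasFDerivAt

lemma hessC_eq (i j : Fin 2) : hessC 2 v y i j =
    fderiv ℝ (fderiv ℝ v) y (EuclideanSpace.single j 1) (EuclideanSpace.single i 1) := by
  unfold hessC
  have h := (hasFDerivAt_fderiv_of_smooth hW hv hy).clm_apply
    (hasFDerivAt_const (EuclideanSpace.single i (1 : ℝ)) y)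
  rw [h.fderiv]
  simp

lemma hodOp_eq (h1 : 1 + gradC 2 v y 1 ≠ 0) :
    (1 + gradC 2 v y 1) ^ 2 * hodOp 2 (by norm_num) v y =
      fderiv ℝ (fderiv ℝ v) y !₂[1 + gradC 2 v y 1, gradC 2 v y 0]
          !₂[1 + gradC 2 v y 1, gradC 2 v y 0]
        + fderiv ℝ (fderiv ℝ v) y !₂[0, 1] !₂[0, 1] := by
  have hlast : ∀ h, lastIdx 2 h = 1 := fun _ => rfl
  have hvec : ∀ α β : ℝ, !₂[α, β] = α • EuclideanSpace.single (0 : Fin 2) (1 : ℝ)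
      + β • EuclideanSpace.single (1 : Fin 2) (1 : ℝ) := fun α β => by
    ext i
    fin_cases i <;> simp
  simp only [hodOp, Fin.sum_univ_two, hodA, tangSq, hlast, hvec, map_add, map_smul,
    add_apply, smul_apply, smul_eq_mul,
    ← hessC_eq hW hv hy]
  simp
  field_simp
  ring

variable {t : ℝ} (hn : 0 < y 0 ^ 2 + y 1 ^ 2)

include hn

lemma hasDerivAt_comparison (α β : ℝ) : ∀ᶠ τ : ℝ in 𝓝 0,
    HasDerivAt (fun τ : ℝ => t * v (y + τ • !₂[α, β]) -
        t ^ 2 * barrier (y 0 + τ * α) (y 1 + τ * β))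
      (t * fderiv ℝ v (y + τ • !₂[α, β]) !₂[α, β] -
        t ^ 2 * barrierD (y 0 + τ * α) (y 1 + τ * β) α β) τ := by
  have hq : ∀ᶠ τ : ℝ in 𝓝 0, 0 < (y 0 + τ * α) ^ 2 + (y 1 + τ * β) ^ 2 := by
    have hc : ContinuousAt (fun τ : ℝ => (y 0 + τ * α) ^ 2 + (y 1 + τ * β) ^ 2) 0 := by fun_prop
    exact hc.eventually (lt_mem_nhds (by simpa using hn))
  filter_upwards [eventually_line_mem hW hy !₂[α, β], hq] with τ h1 h2
  have h3 : HasDerivAt (fun x : ℝ => v (y + x • !₂[α, β])) _ τ :=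
    (hasFDerivAt_of_smooth hW hv h1).comp_hasDerivAt τ (hasDerivAt_add_smul y !₂[α, β] τ)
  exact (h3.const_mul t).sub ((hasDerivAt_barrier (y 0) (y 1) α β τ h2).const_mul (t ^ 2))

lemma hasDerivAt_comparison_deriv (α β : ℝ) :
    HasDerivAt (fun τ : ℝ => t * fderiv ℝ v (y + τ • !₂[α, β]) !₂[α, β] -
        t ^ 2 * barrierD (y 0 + τ * α) (y 1 + τ * β) α β)
      (t * fderiv ℝ (fderiv ℝ v) y !₂[α, β] !₂[α, β] - t ^ 2 * barrierDD (y 0) (y 1) α β) 0 := by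
  have hy0 : HasFDerivAt (fderiv ℝ v) (fderiv ℝ (fderiv ℝ v) y) (y + (0 : ℝ) • !₂[α, β]) := by
    simpa using hasFDerivAt_fderiv_of_smooth hW hv hy
  have h3 : HasDerivAt (fun x : ℝ => fderiv ℝ v (y + x • !₂[α, β]))
      (fderiv ℝ (fderiv ℝ v) y !₂[α, β]) 0 :=
    hy0.comp_hasDerivAt 0 (hasDerivAt_add_smul y !₂[α, β] 0)
  have h4 := h3.clm_apply (hasDerivAt_const (0 : ℝ) (!₂[α, β] : EuclideanSpace ℝ (Fin 2)))
  simp only [map_zero, add_zero] at h4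
  exact (h4.const_mul t).sub ((hasDerivAt_barrierD (y 0) (y 1) α β hn).const_mul (t ^ 2))

lemma isLocalMin_comparison_line {α β : ℝ}
    (hmin : IsLocalMin (fun z => t * v z - t ^ 2 * barrier (z 0) (z 1)) y) :
    t * fderiv ℝ v y !₂[α, β] = t ^ 2 * barrierD (y 0) (y 1) α β ∧
    t ^ 2 * barrierDD (y 0) (y 1) α β ≤ t * fderiv ℝ (fderiv ℝ v) y !₂[α, β] !₂[α, β] := by
  have hc : ContinuousAt (fun τ : ℝ => y + τ • !₂[α, β]) 0 :=
    (hasDerivAt_add_smul y _ 0).continuousAt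
  have hmin' : IsLocalMin (fun τ : ℝ => t * v (y + τ • !₂[α, β]) -
        t ^ 2 * barrier (y 0 + τ * α) (y 1 + τ * β)) 0 := by
    have h : ∀ᶠ z in 𝓝 (y + (0 : ℝ) • !₂[α, β]), t * v y - t ^ 2 * barrier (y 0) (y 1) ≤
        t * v z - t ^ 2 * barrier (z 0) (z 1) := by
      rw [zero_smul, add_zero]
      exact hmin
    replace h := hc.eventually h
    filter_upwards [h] with τ hτ
    simpa using hτ
  have hd := hasDerivAt_comparison hW hv hy (t := t) hn α β
  have h1 := hmin'.hasDerivAt_eq_zero hd.self_of_nhds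
  have h2 := hmin'.second_deriv_nonneg hd (hasDerivAt_comparison_deriv hW hv hy hn α β)
  simp only [zero_smul, zero_mul, add_zero] at h1
  constructor <;> linarith

lemma not_isLocalMin_comparison (hn1 : 1 ≤ y 0 ^ 2 + y 1 ^ 2) (ht : |t| ≤ 1 / 200) (ht0 : t ≠ 0)
    (hsol : hodOp 2 (by norm_num) v y = 0) :
    ¬ IsLocalMin (fun z => t * v z - t ^ 2 * barrier (z 0) (z 1)) y := by
  intro hmin
  have hgrad : ∀ i : Fin 2, ∀ α β : ℝ, EuclideanSpace.single i 1 = !₂[α, β] →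
      gradC 2 v y i = t * barrierD (y 0) (y 1) α β := fun i α β h => by
    have h1 := (isLocalMin_comparison_line hW hv hy hn (α := α) (β := β) hmin).1
    unfold gradC
    rw [h]
    exact mul_left_cancel₀ ht0 (by rw [h1]; ring)
  have h0 := hgrad 0 1 0 (by ext i; fin_cases i <;> simp)
  have h1 := hgrad 1 0 1 (by ext i; fin_cases i <;> simp)
  have key := barrier_interior hn1 ht
  have ha := (isLocalMin_comparison_line hW hv hy hn
    (α := 1 + gradC 2 v y 1) (β := gradC 2 v y 0) hmin).2
  have hb := (isLocalMin_comparison_line hW hv hy hn (α := 0) (β := 1) hmin).2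
  rw [← h0, ← h1] at key
  have hpos : 0 < t ^ 2 := by positivity
  have hne : 1 + gradC 2 v y 1 ≠ 0 := by
    have h2 : |gradC 2 v y 1| ≤ 1 / 200 * 2 := by
      rw [h1, abs_mul]
      exact mul_le_mul ht (abs_barrierD_le hn1) (abs_nonneg _) (by norm_num)
    have h3 := (abs_le.1 h2).1
    linarith
  have hop := hodOp_eq hW hv hy hne
  rw [hsol, mul_zero] at hop
  have := mul_pos hpos key
  have h5 : t * (fderiv ℝ (fderiv ℝ v) y !₂[1 + gradC 2 v y 1, gradC 2 v y 0]
          !₂[1 + gradC 2 v y 1, gradC 2 v y 0]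
        + fderiv ℝ (fderiv ℝ v) y !₂[0, 1] !₂[0, 1]) = 0 := by rw [← hop, mul_zero]
  linarith

lemma not_isLocalMinOn_comparison (hb : y 1 = 0) (hn1 : 1 ≤ y 0 ^ 2) (ht : |t| ≤ 1 / 200)
    (ht0 : t ≠ 0) (hsol : gradC 2 v y 1 = hodN 2 (by norm_num) (fun m => gradC 2 v y m)) :
    ¬ IsLocalMinOn (fun z => t * v z - t ^ 2 * barrier (z 0) (z 1))
      {z : EuclideanSpace ℝ (Fin 2) | 0 ≤ z 1} y := by
  intro hmin
  have hlast : ∀ h, lastIdx 2 h = 1 := fun _ => rfl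
  have hline : ∀ α β : ℝ, ∀ s : Set ℝ, (∀ τ ∈ s, 0 ≤ τ * β) →
      IsLocalMinOn (fun τ : ℝ => t * v (y + τ • !₂[α, β]) -
        t ^ 2 * barrier (y 0 + τ * α) (y 1 + τ * β)) s 0 := fun α β s hs => by
    have hc : Tendsto (fun τ : ℝ => y + τ • !₂[α, β]) (𝓝[s] 0)
        (𝓝[{z : EuclideanSpace ℝ (Fin 2) | 0 ≤ z 1}] y) := by
      refine tendsto_nhdsWithin_iff.2 ⟨?_, ?_⟩
      · have := (hasDerivAt_add_smul y !₂[α, β] 0).continuousAt.tendsto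
        simp only [zero_smul, add_zero] at this
        exact this.mono_left nhdsWithin_le_nhds
      · filter_upwards [self_mem_nhdsWithin] with τ hτ
        simpa [hb] using hs τ hτ
    filter_upwards [hc.eventually hmin] with τ hτ
    simpa using hτ
  have hd0 := (hasDerivAt_comparison hW hv hy (t := t) hn 1 0).self_of_nhds
  have hd1 := (hasDerivAt_comparison hW hv hy (t := t) hn 0 1).self_of_nhds
  have h0 := ((isLocalMinOn_univ_iff.1 (hline 1 0 univ (by simp))).hasDerivAt_eq_zero hd0)
  have h1 := (hline 0 1 (Ici 0) (fun τ hτ => by simpa using hτ)).hasFDerivWithinAt_nonneg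
    hd1.hasFDerivAt.hasFDerivWithinAt
    (y := 1) (mem_posTangentConeAt_of_segment_subset (by
      rw [zero_add]
      exact (convex_Ici (0 : ℝ)).segment_subset (by simp) (by simp)))
  simp only [zero_smul, zero_mul, add_zero, ContinuousLinearMap.toSpanSingleton_apply,
    one_smul, hb] at h0 h1
  have hs0 : (EuclideanSpace.single 0 1 : EuclideanSpace ℝ (Fin 2)) = !₂[1, 0] := by
    ext i; fin_cases i <;> simp
  have hs1 : (EuclideanSpace.single 1 1 : EuclideanSpace ℝ (Fin 2)) = !₂[0, 1] := by
    ext i; fin_cases i <;> simp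
  have hg0 : gradC 2 v y 0 = t * barrierD (y 0) 0 1 0 := by
    unfold gradC
    rw [hs0]
    exact mul_left_cancel₀ ht0 (by linarith)
  have hg1 : t * gradC 2 v y 1 - t ^ 2 * barrierD (y 0) 0 0 1 ≥ 0 := by
    unfold gradC
    rw [hs1]
    exact h1
  have key := barrier_boundary hn1 ht ht0
  have hN : hodN 2 (by norm_num) (fun m => gradC 2 v y m) = √(1 + gradC 2 v y 0 ^ 2) - 1 := by
    simp [hodN, tangSq, hlast]
  rw [hsol, hN, hg0] at hg1
  linarith

end Line

lemma norm_sq_eq_coords (y : EuclideanSpace ℝ (Fin 2)) : y 0 ^ 2 + y 1 ^ 2 = ‖y‖ ^ 2 := by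
  rw [EuclideanSpace.real_norm_sq_eq, Fin.sum_univ_two]

lemma barrier_eq_of_norm {y : EuclideanSpace ℝ (Fin 2)} {ρ : ℝ} (h : ‖y‖ = ρ) (hρ : 0 < ρ) :
    barrier (y 0) (y 1) = Real.log ρ + ρ⁻¹ / 2 + y 1 / (8 * ρ ^ 2) - 5 / 8 := by
  unfold barrier
  rw [norm_sq_eq_coords, h, Real.sqrt_sq hρ.le, Real.log_pow]
  push_cast
  ring

lemma barrier_le_of_norm {y : EuclideanSpace ℝ (Fin 2)} {ρ : ℝ} (h : ‖y‖ = ρ) (hρ : 1 ≤ ρ) :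
    barrier (y 0) (y 1) ≤ Real.log ρ := by
  rw [barrier_eq_of_norm h (by linarith)]
  have h1 : ρ⁻¹ ≤ 1 := inv_le_one_of_one_le₀ hρ
  have h2 : y 1 / (8 * ρ ^ 2) ≤ 1 / 8 := by
    have : y 1 ≤ ρ := h ▸ (le_abs_self _).trans (PiLp.norm_apply_le y 1)
    rw [div_le_div_iff₀ (by positivity) (by norm_num)]
    nlinarith
  linarith

lemma barrier_two_ge {y : EuclideanSpace ℝ (Fin 2)} (h : ‖y‖ = 2) (hy : 0 ≤ y 1) :
    1 / 4 ≤ barrier (y 0) (y 1) := by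
  rw [barrier_eq_of_norm h (by norm_num)]
  have h1 := Real.log_two_gt_d9
  have h2 : 0 ≤ y 1 / (8 * 2 ^ 2) := by positivity
  linarith

lemma continuousAt_barrier {y : EuclideanSpace ℝ (Fin 2)} (hy : 1 ≤ ‖y‖) :
    ContinuousAt (fun z : EuclideanSpace ℝ (Fin 2) => barrier (z 0) (z 1)) y := by
  have hq : 0 < y 0 ^ 2 + y 1 ^ 2 := by
    rw [norm_sq_eq_coords]
    positivity
  have hs : √(y 0 ^ 2 + y 1 ^ 2) ≠ 0 := (Real.sqrt_pos.2 hq).ne'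
  have hq' : y 0 ^ 2 + y 1 ^ 2 ≠ 0 := hq.ne'
  have hq8 : 8 * (y 0 ^ 2 + y 1 ^ 2) ≠ 0 := by positivity
  unfold barrier
  fun_prop (disch := assumption)

lemma isClosed_upperHalf : IsClosed {z : EuclideanSpace ℝ (Fin 2) | 0 ≤ z 1} :=
  isClosed_le continuous_const (by fun_prop)

lemma isCompact_halfAnn (h : 0 < 2) (r : ℝ) : IsCompact (halfAnn 2 h r) := by
  refine Metric.isCompact_of_isClosed_isBounded ?_ ?_
  · exact isClosed_upperHalf.inter
      ((isClosed_le continuous_const continuous_norm).inter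
        (isClosed_le continuous_norm continuous_const))
  · refine (Metric.isBounded_closedBall (x := (0 : EuclideanSpace ℝ (Fin 2))) (r := r)).subset ?_
    intro y hy
    simpa using hy.2.2

lemma isCompact_upSphere (h : 0 < 2) (ρ : ℝ) : IsCompact (upSphere 2 h ρ) := by
  have : upSphere 2 h ρ = {z | 0 ≤ z 1} ∩ Metric.sphere 0 ρ := by
    ext y
    simp [upSphere, show lastIdx 2 h = 1 from rfl]
  rw [this]
  exact (isCompact_sphere _ _).inter_left isClosed_upperHalf

lemma upSphere_nonempty (h : 0 < 2) {ρ : ℝ} (hρ : 0 ≤ ρ) : (upSphere 2 h ρ).Nonempty := by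
  refine ⟨EuclideanSpace.single 1 ρ, ?_, ?_⟩
  · simpa [show lastIdx 2 h = 1 from rfl] using hρ
  · simp [abs_of_nonneg hρ]

lemma IsHodSol.le_comparison {h : 0 < 2} {r t m : ℝ} {v : EuclideanSpace ℝ (Fin 2) → ℝ}
    (hsol : IsHodSol 2 h v (halfAnn 2 h r)) (ht : |t| ≤ 1 / 200) (ht0 : t ≠ 0)
    (h1 : ∀ y ∈ upSphere 2 h 1, m ≤ t * v y - t ^ 2 * barrier (y 0) (y 1))
    (hr : ∀ y ∈ upSphere 2 h r, m ≤ t * v y - t ^ 2 * barrier (y 0) (y 1)) :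
    ∀ y ∈ halfAnn 2 h r, m ≤ t * v y - t ^ 2 * barrier (y 0) (y 1) := by
  obtain ⟨⟨W, hW, hUW, hv⟩, hint, hbdry⟩ := hsol
  intro y hy
  have hcont : ContinuousOn (fun z => t * v z - t ^ 2 * barrier (z 0) (z 1)) (halfAnn 2 h r) :=
    fun z hz => ((((hv.contDiffAt (hW.mem_nhds (hUW hz))).continuousAt.const_mul t).sub
      ((continuousAt_barrier hz.2.1).const_mul (t ^ 2)))).continuousWithinAt
  obtain ⟨z, hz, hmin⟩ := (isCompact_halfAnn h r).exists_isMinOn ⟨y, hy⟩ hcont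
  refine le_trans ?_ (hmin hy)
  obtain ⟨hz0, hz1, hzr⟩ := hz
  rcases hz1.eq_or_lt with hz1' | hz1'
  · exact h1 z ⟨hz0, hz1'.symm⟩
  rcases hzr.eq_or_lt with hzr' | hzr'
  · exact hr z ⟨hz0, hzr'⟩
  exfalso
  have hn1 : 1 ≤ z 0 ^ 2 + z 1 ^ 2 := by
    rw [norm_sq_eq_coords]
    nlinarith
  have hloc : IsLocalMinOn (fun z => t * v z - t ^ 2 * barrier (z 0) (z 1))
      {z : EuclideanSpace ℝ (Fin 2) | 0 ≤ z 1} z := by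
    have hann : ∀ᶠ x in 𝓝 z, 1 < ‖x‖ ∧ ‖x‖ < r :=
      (continuous_norm.continuousAt.eventually (lt_mem_nhds hz1')).and
        (continuous_norm.continuousAt.eventually (gt_mem_nhds hzr'))
    filter_upwards [nhdsWithin_le_nhds hann, self_mem_nhdsWithin] with x hx hx0
    exact hmin ⟨hx0, hx.1.le, hx.2.le⟩
  have hzU : z ∈ halfAnn 2 h r := ⟨hz0, hz1, hzr⟩
  rcases hz0.eq_or_lt with hz0' | hz0'
  · have hb : z 1 = 0 := hz0'.symm
    exact not_isLocalMinOn_comparison hW hv (hUW hzU) (by linarith) hb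
      (by simpa [hb] using hn1) ht ht0 (hbdry z hzU hb) hloc
  · refine not_isLocalMin_comparison hW hv (hUW hzU) (by linarith) hn1 ht ht0
      (hint z hzU hz0') (hloc.isLocalMin ?_)
    have hpos : ∀ᶠ x : EuclideanSpace ℝ (Fin 2) in 𝓝 z, 0 < x 1 :=
      (by fun_prop : ContinuousAt (fun x : EuclideanSpace ℝ (Fin 2) => x 1) z).eventually
        (lt_mem_nhds hz0')
    exact hpos.mono fun x hx => hx.le

lemma IsHodSol.growth {h : 0 < 2} {r σ : ℝ} {v : EuclideanSpace ℝ (Fin 2) → ℝ}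
    (hσ : |σ| = 1) (hr : 2 ≤ r) (hsol : IsHodSol 2 h v (halfAnn 2 h r))
    (hgrad : ∀ y ∈ halfAnn 2 h r, ‖fderiv ℝ v y‖ ≤ 1 / 1000) :
    sInf ((fun y => σ * v y) '' upSphere 2 h r) ≤
      sInf ((fun y => σ * v y) '' upSphere 2 h 1) + 4 * (1 + Real.log r) *
        max (sInf ((fun y => σ * v y) '' upSphere 2 h 2) -
          sInf ((fun y => σ * v y) '' upSphere 2 h 1)) 0 := by
  obtain ⟨W, hW, hUW, hv⟩ := hsol.1
  have hdiff : ∀ y ∈ halfAnn 2 h r, DifferentiableAt ℝ v y := fun y hy =>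
    (hasFDerivAt_of_smooth hW hv (hUW hy)).differentiableAt
  have hsub : ∀ ρ, 1 ≤ ρ → ρ ≤ r → upSphere 2 h ρ ⊆ halfAnn 2 h r := fun ρ h1 h2 y hy =>
    ⟨hy.1, hy.2 ▸ h1, hy.2 ▸ h2⟩
  have hcomp : ∀ ρ, 1 ≤ ρ → ρ ≤ r → IsCompact ((fun y => σ * v y) '' upSphere 2 h ρ) :=
    fun ρ h1 h2 => (isCompact_upSphere h ρ).image_of_continuousOn fun y hy =>
      ((hdiff y (hsub ρ h1 h2 hy)).continuousAt.const_mul σ).continuousWithinAt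
  have hle : ∀ ρ, 1 ≤ ρ → ρ ≤ r → ∀ y ∈ upSphere 2 h ρ,
      sInf ((fun y => σ * v y) '' upSphere 2 h ρ) ≤ σ * v y := fun ρ h1 h2 y hy =>
    csInf_le (hcomp ρ h1 h2).bddBelow (mem_image_of_mem _ hy)
  have hL : 0 < Real.log r := Real.log_pos (by linarith)
  have hle1 := hle 1 le_rfl (by linarith)
  have hle2 := hle 2 (by norm_num) hr
  have hler := hle r (by linarith) le_rfl
  have hmem1 := (hcomp 1 le_rfl (by linarith)).sInf_mem ((upSphere_nonempty h zero_le_one).image _)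
  have hne2 := (upSphere_nonempty h (zero_le_two (α := ℝ))).image (fun y => σ * v y)
  set m1 := sInf ((fun y => σ * v y) '' upSphere 2 h 1)
  set m2 := sInf ((fun y => σ * v y) '' upSphere 2 h 2) with hm2
  set mr := sInf ((fun y => σ * v y) '' upSphere 2 h r)
  have hm21 : m2 ≤ m1 + 1 / 1000 := by
    obtain ⟨y, hy, hym⟩ := hmem1
    have hy2 : (2 : ℝ) • y ∈ upSphere 2 h 2 := by
      refine ⟨?_, by rw [norm_smul, hy.2]; norm_num⟩
      have := hy.1
      simpa using this
    have hseg : segment ℝ y ((2 : ℝ) • y) ⊆ halfAnn 2 h r := by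
      rintro z ⟨a, b, ha, hb, hab, rfl⟩
      have hz : a • y + b • (2 : ℝ) • y = (1 + b) • y := by
        rw [smul_smul, ← add_smul]
        congr 1
        linarith
      have hn : ‖(1 + b) • y‖ = 1 + b := by
        rw [norm_smul, hy.2, mul_one, Real.norm_of_nonneg (by linarith)]
      rw [hz]
      refine ⟨?_, by rw [hn]; linarith, by rw [hn]; linarith⟩
      exact mul_nonneg (by linarith) hy.1
    have hmv := (convex_segment y ((2 : ℝ) • y)).norm_image_sub_le_of_norm_fderiv_le
      (fun z hz => hdiff z (hseg hz)) (fun z hz => hgrad z (hseg hz))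
      (left_mem_segment ℝ y _) (right_mem_segment ℝ y _)
    have hny : ‖(2 : ℝ) • y - y‖ = 1 := by
      rw [two_smul, add_sub_cancel_right]
      exact hy.2
    rw [hny, mul_one, Real.norm_eq_abs] at hmv
    have h1 : |σ * (v ((2 : ℝ) • y) - v y)| ≤ 1 / 1000 := by rwa [abs_mul, hσ, one_mul]
    have h2 := (abs_le.1 h1).2
    have h3 := hle2 _ hy2
    have h4 : σ * v y = m1 := hym
    linarith
  by_contra! hcon
  have hδ := le_max_right (m2 - m1) 0
  have hδ' := le_max_left (m2 - m1) 0
  set δ := max (m2 - m1) 0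
  have hm : 0 < mr - m1 := by
    have : 0 ≤ 4 * (1 + Real.log r) * δ := by positivity
    linarith
  obtain ⟨ε, hε⟩ : ∃ ε, ε = min ((mr - m1) / (1 + Real.log r)) (1 / 200) := ⟨_, rfl⟩
  have hε0 : 0 < ε := hε ▸ lt_min (by positivity) (by norm_num)
  have hε1 : ε ≤ 1 / 200 := hε ▸ min_le_right _ _
  have hε2 : ε * (1 + Real.log r) ≤ mr - m1 :=
    (le_div_iff₀ (by positivity)).1 (hε ▸ min_le_left _ _)
  have hσ0 : σ ≠ 0 := by
    rintro rfl
    simp at hσ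
  have hσ2 : σ ^ 2 = 1 := by rw [← sq_abs, hσ, one_pow]
  have hu : ∀ y : EuclideanSpace ℝ (Fin 2), (σ * ε) * v y - (σ * ε) ^ 2 * barrier (y 0) (y 1) =
      ε * (σ * v y - ε * barrier (y 0) (y 1)) := fun y => by
    rw [mul_pow, hσ2]
    ring
  have hcmp := hsol.le_comparison (t := σ * ε) (m := ε * m1)
    (by rw [abs_mul, hσ, one_mul, abs_of_pos hε0]; exact hε1) (mul_ne_zero hσ0 hε0.ne')
    (fun y hy => by
      rw [hu]
      have h1 := barrier_le_of_norm hy.2 le_rfl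
      rw [Real.log_one] at h1
      have h2 := hle1 y hy
      gcongr
      nlinarith)
    (fun y hy => by
      rw [hu]
      have h1 := barrier_le_of_norm hy.2 (by linarith)
      have h2 := hler y hy
      gcongr
      nlinarith)
  have hm2' : m1 + ε / 4 ≤ m2 := by
    rw [hm2]
    refine le_csInf hne2 ?_
    rintro _ ⟨y, hy, rfl⟩
    have h1 := hcmp y (hsub 2 (by norm_num) hr hy)
    rw [hu] at h1
    have h2 := le_of_mul_le_mul_left h1 hε0
    have h3 := barrier_two_ge hy.2 hy.1
    simp only
    nlinarith
  rcases min_choice ((mr - m1) / (1 + Real.log r)) (1 / 200) with hc | hc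
  · have h1 : ε * (1 + Real.log r) = mr - m1 := by
      rw [hε, hc, div_mul_cancel₀ _ (by positivity)]
    have h2 : ε ≤ 4 * δ := by linarith
    nlinarith
  · rw [hc] at hε
    linarith

/-- Growth bound for solutions on the half annulus, `d = 2`, with logarithmic factor. -/
theorem stmt3 :
    ∃ η₀ : ℝ, 0 < η₀ ∧ ∃ C : ℝ, 1 ≤ C ∧
      ∀ r : ℝ, 2 ≤ r → ∀ v : EuclideanSpace ℝ (Fin 2) → ℝ,
        IsHodSol 2 (by norm_num) v (halfAnn 2 (by norm_num) r) →
        (∀ y ∈ halfAnn 2 (by norm_num) r, ‖fderiv ℝ v y‖ ≤ η₀) →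
        sSup (v '' upSphere 2 (by norm_num) 1) -
            C * (1 + Real.log r) *
              max (sSup (v '' upSphere 2 (by norm_num) 1) -
                sSup (v '' upSphere 2 (by norm_num) 2)) 0
          ≤ sSup (v '' upSphere 2 (by norm_num) r) ∧
        sInf (v '' upSphere 2 (by norm_num) r)
          ≤ sInf (v '' upSphere 2 (by norm_num) 1) +
            C * (1 + Real.log r) *
              max (sInf (v '' upSphere 2 (by norm_num) 2) -
                sInf (v '' upSphere 2 (by norm_num) 1)) 0 := by
  refine ⟨1 / 1000, by norm_num, 4, by norm_num, fun r hr v hsol hgrad => ⟨?_, ?_⟩⟩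
  · have h := hsol.growth (σ := -1) (by simp) hr hgrad
    have himg : ∀ S : Set (EuclideanSpace ℝ (Fin 2)),
        sInf ((fun y => -1 * v y) '' S) = -sSup (v '' S) := fun S => by
      rw [← Real.sInf_neg, ← Set.image_neg_eq_neg, Set.image_image]
      simp
    rw [himg, himg, himg] at h
    have hmax : ∀ a b : ℝ, -b - -a = a - b := fun a b => by ring
    rw [hmax] at h
    linarith
  · simpa using hsol.growth (σ := 1) (by simp) hr hgrad
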